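/- For every s ≥ 1, the Minkowski sum (K(b^s,1,1) ∪ K(b^s,1,2)) + (K(c^s,1,2) ∪ K(c^s,1,3)) is exactly the closed interval [ [0; b^s, 1, 1, \overline{3,1}] + [0; c^s, 1, 2, \overline{3,1}] , [0; b^s, 1, 2, \overline{1,3}] + [0; c^s, 1, 3, \overline{1,3}] ]. -/

import Mathlib

open Filter Set
open scoped Pointwise

noncomputable section

/-- The `n`-th convergent of the continued fraction `[0; a 0, a 1, a 2, …]`. -/
def cfConv : ℕ → (ℕ → ℕ) → ℝ
  | 0, _ => 0
  | n + 1, a => 1 / (a 0 + cfConv n fun i => a (i + 1))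

/-- The value `[0; a 0, a 1, a 2, …]` of the infinite continued fraction with
partial quotients `a 0, a 1, …` (the limit of its convergents). -/
def cfVal (a : ℕ → ℕ) : ℝ := limUnder atTop fun n => cfConv n a

/-- The sequence of partial quotients obtained by concatenating the finite word `b`
with the sequence `θ`. -/
def app (b : List ℕ) (θ : ℕ → ℕ) : ℕ → ℕ := fun n =>
  if h : n < b.length then b.get ⟨n, h⟩ else θ (n - b.length)

/-- The forbidden pairs of consecutive partial quotients. -/
def badPairs : Set (ℕ × ℕ) := {(1, 4), (2, 4)}

/-- The set `D` of sequences with entries in `{1,2,3,4}` avoiding the pairs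
`(1,4)` and `(2,4)`. -/
def Dset : Set (ℕ → ℕ) :=
  {θ | (∀ n, θ n ∈ ({1, 2, 3, 4} : Set ℕ)) ∧ ∀ n, (θ n, θ (n + 1)) ∉ badPairs}

/-- The Cantor set `K(b) = {[0; b, θ] : θ ∈ D, (b_s, θ_1) ∉ {(1,4),(2,4)}}`. -/
def Kb (b : List ℕ) : Set ℝ :=
  {x | ∃ θ ∈ Dset, (∀ d, b.getLast? = some d → (d, θ 0) ∉ badPairs) ∧
    x = cfVal (app b θ)}

/-- The set `K̃(b) ⊆ K(b)` of values `[0; b, θ]` with moreover `(θ_1, θ_2) ≠ (1,3)`. -/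
def Ktil (b : List ℕ) : Set ℝ :=
  {x | ∃ θ ∈ Dset, (∀ d, b.getLast? = some d → (d, θ 0) ∉ badPairs) ∧
    (θ 0, θ 1) ≠ (1, 3) ∧ x = cfVal (app b θ)}

/-- The word `b^s = (1,4)_s`. -/
def bW (s : ℕ) : List ℕ := (List.replicate s [1, 4]).flatten

/-- The word `c^s = (1,4)_{s-1}, 1, 3`. -/
def cW (s : ℕ) : List ℕ := bW (s - 1) ++ [1, 3]

/-- The periodic sequence `\overline{1,3}`. -/
def per13 : ℕ → ℕ := fun n => if n % 2 = 0 then 1 else 3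

/-- The periodic sequence `\overline{3,1}`. -/
def per31 : ℕ → ℕ := fun n => if n % 2 = 0 then 3 else 1

/-! ### Continued fraction values -/

lemma cfConv_mem_Icc (n : ℕ) {a : ℕ → ℕ} (ha : ∀ i, 1 ≤ a i) : cfConv n a ∈ Icc (0 : ℝ) 1 := by
  induction n generalizing a with
  | zero => simp [cfConv]
  | succ n ih =>
    have h := (ih fun i => ha (i + 1)).1
    have h1 : (1 : ℝ) ≤ a 0 := by exact_mod_cast ha 0
    refine ⟨by simp only [cfConv]; positivity, ?_⟩
    simp only [cfConv]
    rw [div_le_one (by positivity)]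
    linarith

lemma abs_two_step_sub_le {a b x y : ℝ} (ha : 1 ≤ a) (hb : 1 ≤ b) (hx : 0 ≤ x) (hy : 0 ≤ y) :
    |1 / (a + 1 / (b + x)) - 1 / (a + 1 / (b + y))| ≤ 1 / 4 * |x - y| := by
  have key : 1 / (a + 1 / (b + x)) - 1 / (a + 1 / (b + y)) =
      (x - y) / ((a * (b + x) + 1) * (a * (b + y) + 1)) := by
    field_simp
    ring
  have h2 : 2 ≤ a * (b + x) + 1 := by nlinarith
  have h3 : 2 ≤ a * (b + y) + 1 := by nlinarith
  rw [key, abs_div, abs_of_pos (by positivity : 0 < (a * (b + x) + 1) * (a * (b + y) + 1)),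
    div_le_iff₀ (by positivity)]
  nlinarith [abs_nonneg (x - y), mul_le_mul h2 h3 (by norm_num) (by linarith)]

lemma abs_cfConv_add_sub_le (n k : ℕ) {a : ℕ → ℕ} (ha : ∀ i, 1 ≤ a i) :
    |cfConv (2 * n + k) a - cfConv (2 * n) a| ≤ (1 / 4 : ℝ) ^ n := by
  induction n generalizing a with
  | zero =>
    have h := cfConv_mem_Icc k ha
    simpa [cfConv, abs_of_nonneg h.1] using h.2
  | succ n ih =>
    have h0 : (1 : ℝ) ≤ a 0 := by exact_mod_cast ha 0
    have h1 : (1 : ℝ) ≤ a 1 := by exact_mod_cast ha 1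
    have ha' : ∀ i, 1 ≤ a (i + 1 + 1) := fun i => ha _
    have e1 : 2 * (n + 1) + k = 2 * n + k + 1 + 1 := by ring
    have e2 : 2 * (n + 1) = 2 * n + 1 + 1 := by ring
    rw [e1, e2]
    simp only [cfConv, zero_add]
    refine (abs_two_step_sub_le h0 h1 (cfConv_mem_Icc _ ha').1 (cfConv_mem_Icc _ ha').1).trans ?_
    rw [pow_succ']
    gcongr
    exact ih ha'

lemma tendsto_cfConv {a : ℕ → ℕ} (ha : ∀ i, 1 ≤ a i) :
    Tendsto (fun n => cfConv n a) atTop (nhds (cfVal a)) := by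
  have hc : CauchySeq fun n => cfConv n a := by
    refine Metric.cauchySeq_iff'.2 fun ε hε => ?_
    obtain ⟨n, hn⟩ := exists_pow_lt_of_lt_one hε (by norm_num : (1 / 4 : ℝ) < 1)
    refine ⟨2 * n, fun m hm => ?_⟩
    obtain ⟨k, rfl⟩ := Nat.exists_eq_add_of_le hm
    exact (abs_cfConv_add_sub_le n k ha).trans_lt hn
  exact hc.tendsto_limUnder

lemma cfVal_mem_Icc {a : ℕ → ℕ} (ha : ∀ i, 1 ≤ a i) : cfVal a ∈ Icc (0 : ℝ) 1 :=
  isClosed_Icc.mem_of_tendsto (tendsto_cfConv ha) (.of_forall fun n => cfConv_mem_Icc n ha)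

lemma abs_cfVal_sub_le (n : ℕ) {a : ℕ → ℕ} (ha : ∀ i, 1 ≤ a i) :
    |cfVal a - cfConv (2 * n) a| ≤ (1 / 4 : ℝ) ^ n := by
  have h : Tendsto (fun k => |cfConv k a - cfConv (2 * n) a|) atTop
      (nhds |cfVal a - cfConv (2 * n) a|) := ((tendsto_cfConv ha).sub_const _).abs
  refine le_of_tendsto h ?_
  filter_upwards [eventually_ge_atTop (2 * n)] with m hm
  obtain ⟨k, rfl⟩ := Nat.exists_eq_add_of_le hm
  exact abs_cfConv_add_sub_le n k ha

lemma cfVal_eq {a : ℕ → ℕ} (ha : ∀ i, 1 ≤ a i) :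
    cfVal a = 1 / (a 0 + cfVal fun i => a (i + 1)) := by
  have ha' : ∀ i, 1 ≤ a (i + 1) := fun i => ha _
  have h0 : (1 : ℝ) ≤ a 0 := by exact_mod_cast ha 0
  have h1 := (cfVal_mem_Icc ha').1
  refine tendsto_nhds_unique ((tendsto_add_atTop_iff_nat 1).2 (tendsto_cfConv ha)) ?_
  exact tendsto_const_nhds.div (tendsto_const_nhds.add (tendsto_cfConv ha')) (by positivity)

lemma continuous_cfConv_restrict (n : ℕ) :
    ContinuousOn (fun a => cfConv n a) {a : ℕ → ℕ | ∀ i, 1 ≤ a i} := by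
  induction n with
  | zero => exact continuousOn_const
  | succ n ih =>
    have hshift : ContinuousOn (fun a : ℕ → ℕ => cfConv n fun i => a (i + 1))
        {a : ℕ → ℕ | ∀ i, 1 ≤ a i} :=
      ih.comp (f := fun (a : ℕ → ℕ) i => a (i + 1))
        (continuous_pi fun i => continuous_apply (i + 1)).continuousOn
        fun a ha i => ha (i + 1)
    have h0 : Continuous fun a : ℕ → ℕ => (a 0 : ℝ) :=
      continuous_of_discreteTopology.comp (continuous_apply 0)
    refine continuousOn_const.div (h0.continuousOn.add hshift) fun a ha => ?_
    have h1 : (1 : ℝ) ≤ a 0 := by exact_mod_cast ha 0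
    have h2 := (cfConv_mem_Icc n fun i => ha (i + 1)).1
    positivity

lemma continuousOn_cfVal : ContinuousOn cfVal {a : ℕ → ℕ | ∀ i, 1 ≤ a i} := by
  have h : TendstoUniformlyOn (fun (n : ℕ) (a : ℕ → ℕ) => cfConv (2 * n) a) cfVal atTop
      {a : ℕ → ℕ | ∀ i, 1 ≤ a i} := by
    refine Metric.tendstoUniformlyOn_iff.2 fun ε hε => ?_
    obtain ⟨N, hN⟩ := exists_pow_lt_of_lt_one hε (by norm_num : (1 / 4 : ℝ) < 1)
    filter_upwards [eventually_ge_atTop N] with n hn a ha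
    calc |cfVal a - cfConv (2 * n) a| ≤ (1 / 4 : ℝ) ^ n := abs_cfVal_sub_le n ha
      _ ≤ (1 / 4 : ℝ) ^ N := pow_le_pow_of_le_one (by norm_num) (by norm_num) hn
      _ < ε := hN
  exact h.continuousOn (.of_forall fun n => continuous_cfConv_restrict (2 * n))

/-! ### Finite prefixes -/

/-- `cfWord w x` is `[0; w₁, …, w_k + x]`. -/
def cfWord (w : List ℕ) (x : ℝ) : ℝ := w.foldr (fun d y => 1 / (d + y)) x

lemma cfWord_append (v w : List ℕ) (x : ℝ) : cfWord (v ++ w) x = cfWord v (cfWord w x) := by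
  simp [cfWord]

lemma app_nil (θ : ℕ → ℕ) : app [] θ = θ := by
  funext n
  simp [app]

lemma app_cons_zero (d : ℕ) (w : List ℕ) (θ : ℕ → ℕ) : app (d :: w) θ 0 = d := by
  simp [app]

lemma app_cons_succ (d : ℕ) (w : List ℕ) (θ : ℕ → ℕ) (n : ℕ) :
    app (d :: w) θ (n + 1) = app w θ n := by
  simp [app]

lemma one_le_app {w : List ℕ} {θ : ℕ → ℕ} (hw : ∀ d ∈ w, 1 ≤ d) (hθ : ∀ i, 1 ≤ θ i) (n : ℕ) :
    1 ≤ app w θ n := by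
  unfold app
  split_ifs
  · exact hw _ (List.get_mem _ _)
  · exact hθ _

lemma cfVal_app {w : List ℕ} {θ : ℕ → ℕ} (hw : ∀ d ∈ w, 1 ≤ d) (hθ : ∀ i, 1 ≤ θ i) :
    cfVal (app w θ) = cfWord w (cfVal θ) := by
  induction w with
  | nil => simp [app_nil, cfWord]
  | cons d w ih =>
    rw [cfVal_eq (one_le_app hw hθ), app_cons_zero]
    simp only [app_cons_succ]
    rw [show (fun i => app w θ i) = app w θ from rfl,
      ih fun e he => hw e (List.mem_cons_of_mem _ he)]
    rfl

/-! ### The tail sets -/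

lemma one_le_of_mem_Dset {θ : ℕ → ℕ} (h : θ ∈ Dset) (n : ℕ) : 1 ≤ θ n := by
  have := h.1 n
  simp only [mem_insert_iff, mem_singleton_iff] at this
  omega

lemma isClosed_setOf_eval {p : ℕ → ℕ → Prop} (i j : ℕ) :
    IsClosed {θ : ℕ → ℕ | p (θ i) (θ j)} :=
  (isClosed_discrete {x : ℕ × ℕ | p x.1 x.2}).preimage
    (f := fun θ : ℕ → ℕ => (θ i, θ j)) ((continuous_apply i).prodMk (continuous_apply j))

lemma isCompact_Dset : IsCompact Dset := by
  have h1 : IsCompact (univ.pi fun _ : ℕ => ({1, 2, 3, 4} : Set ℕ)) :=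
    isCompact_univ_pi fun _ => (toFinite _).isCompact
  have h2 : IsClosed {θ : ℕ → ℕ | ∀ n, (θ n, θ (n + 1)) ∉ badPairs} := by
    rw [ofPred_forall]
    exact isClosed_iInter fun n =>
      isClosed_setOf_eval (p := fun x y => (x, y) ∉ badPairs) n (n + 1)
  have h3 : Dset = (univ.pi fun _ : ℕ => ({1, 2, 3, 4} : Set ℕ)) ∩
      {θ : ℕ → ℕ | ∀ n, (θ n, θ (n + 1)) ∉ badPairs} := by
    ext θ
    simp [Dset, Set.mem_pi]
  rw [h3]
  exact h1.inter_right h2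

/-- Values of the sequences in `D`. -/
def fullTails : Set ℝ := cfVal '' Dset

/-- Values of the sequences in `D` that may follow a partial quotient `1` or `2`. -/
def lowTails : Set ℝ := cfVal '' {θ ∈ Dset | θ 0 ≠ 4}

lemma isCompact_fullTails : IsCompact fullTails :=
  isCompact_Dset.image_of_continuousOn
    (continuousOn_cfVal.mono fun _ h => one_le_of_mem_Dset h)

lemma isCompact_lowTails : IsCompact lowTails := by
  have h : IsCompact {θ ∈ Dset | θ 0 ≠ 4} :=
    isCompact_Dset.inter_right (isClosed_setOf_eval (p := fun x _ => x ≠ 4) 0 0)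
  exact h.image_of_continuousOn
    (continuousOn_cfVal.mono fun _ hθ => one_le_of_mem_Dset hθ.1)

lemma lowTails_subset_fullTails : lowTails ⊆ fullTails := image_mono fun _ h => h.1

lemma nonneg_of_mem_fullTails {x : ℝ} (hx : x ∈ fullTails) : 0 ≤ x := by
  obtain ⟨θ, hθ, rfl⟩ := hx
  exact (cfVal_mem_Icc (one_le_of_mem_Dset hθ)).1

/-- The sequences allowed after the partial quotient `d`. -/
def tailsAfter (d : ℕ) : Set ℝ := if d ≤ 2 then lowTails else fullTails

lemma mem_tailsAfter {d : ℕ} (hd : d ∈ ({1, 2, 3, 4} : Set ℕ)) {x : ℝ} :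
    x ∈ tailsAfter d ↔ ∃ θ ∈ Dset, (d, θ 0) ∉ badPairs ∧ cfVal θ = x := by
  rcases hd with rfl | rfl | rfl | rfl <;>
    simp [tailsAfter, lowTails, fullTails, badPairs, and_assoc]

lemma tailsAfter_subset_fullTails (d : ℕ) : tailsAfter d ⊆ fullTails := by
  unfold tailsAfter
  split_ifs
  exacts [lowTails_subset_fullTails, subset_rfl]

lemma app_singleton_mem_Dset {d : ℕ} (hd : d ∈ ({1, 2, 3, 4} : Set ℕ)) {θ : ℕ → ℕ}
    (hθ : θ ∈ Dset) (h : (d, θ 0) ∉ badPairs) : app [d] θ ∈ Dset := by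
  refine ⟨fun n => ?_, fun n => ?_⟩
  · cases n with
    | zero => rwa [app_cons_zero]
    | succ n => rw [app_cons_succ, app_nil]; exact hθ.1 n
  · cases n with
    | zero => rwa [app_cons_zero, app_cons_succ, app_nil]
    | succ n => rw [app_cons_succ, app_cons_succ, app_nil]; exact hθ.2 n

lemma one_div_mem_fullTails {d : ℕ} (hd : d ∈ ({1, 2, 3, 4} : Set ℕ)) {x : ℝ}
    (hx : x ∈ tailsAfter d) : 1 / (d + x) ∈ fullTails := by
  obtain ⟨θ, hθ, h, rfl⟩ := (mem_tailsAfter hd).1 hx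
  refine ⟨app [d] θ, app_singleton_mem_Dset hd hθ h, ?_⟩
  rw [cfVal_app (fun e he => ?_) (one_le_of_mem_Dset hθ)]
  · simp [cfWord]
  · rcases hd with rfl | rfl | rfl | rfl <;> simp_all

lemma one_div_mem_lowTails {d : ℕ} (hd : d ∈ ({1, 2, 3} : Set ℕ)) {x : ℝ}
    (hx : x ∈ tailsAfter d) : 1 / (d + x) ∈ lowTails := by
  have hd' : d ∈ ({1, 2, 3, 4} : Set ℕ) := by
    rcases hd with rfl | rfl | rfl <;> simp
  obtain ⟨θ, hθ, h, rfl⟩ := (mem_tailsAfter hd').1 hx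
  refine ⟨app [d] θ, ⟨app_singleton_mem_Dset hd' hθ h, ?_⟩, ?_⟩
  · rw [app_cons_zero]
    rcases hd with rfl | rfl | rfl <;> simp
  rw [cfVal_app (fun e he => ?_) (one_le_of_mem_Dset hθ)]
  · simp [cfWord]
  · rcases hd with rfl | rfl | rfl <;> simp_all

lemma exists_eq_one_div {θ : ℕ → ℕ} (hθ : θ ∈ Dset) :
    ∃ x ∈ tailsAfter (θ 0), cfVal θ = 1 / (θ 0 + x) :=
  ⟨_, (mem_tailsAfter (hθ.1 0)).2 ⟨fun i => θ (i + 1),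
    ⟨fun n => hθ.1 (n + 1), fun n => hθ.2 (n + 1)⟩, hθ.2 0, rfl⟩,
    cfVal_eq (one_le_of_mem_Dset hθ)⟩

lemma Kb_append_singleton {w : List ℕ} (hw : ∀ e ∈ w, 1 ≤ e) {d : ℕ}
    (hd : d ∈ ({1, 2, 3, 4} : Set ℕ)) :
    Kb (w ++ [d]) = (fun x => cfWord w (1 / (d + x))) '' tailsAfter d := by
  have h1 : ∀ e ∈ w ++ [d], 1 ≤ e := by
    intro e he
    rcases List.mem_append.1 he with he | he
    · exact hw e he
    · rcases hd with rfl | rfl | rfl | rfl <;> simp_all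
  ext y
  simp only [Kb, mem_ofPred_eq, mem_image, mem_tailsAfter hd, List.getLast?_append,
    List.getLast?_singleton, Option.some_or, Option.some.injEq, forall_eq']
  constructor
  · rintro ⟨θ, hθ, h, rfl⟩
    refine ⟨_, ⟨θ, hθ, h, rfl⟩, ?_⟩
    rw [cfVal_app h1 (one_le_of_mem_Dset hθ), cfWord_append]
    rfl
  · rintro ⟨_, ⟨θ, hθ, h, rfl⟩, rfl⟩
    refine ⟨θ, hθ, h, ?_⟩
    rw [cfVal_app h1 (one_le_of_mem_Dset hθ), cfWord_append]
    rfl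

/-! ### Extremal tails -/

/-- The value of `[0; \overline{1,3}]`, see `cfVal_per13`. -/
def maxTail : ℝ := (√21 - 3) / 2

lemma maxTail_sq : maxTail ^ 2 = 3 - 3 * maxTail := by
  have h : √21 ^ 2 = 21 := Real.sq_sqrt (by norm_num)
  unfold maxTail
  linear_combination h / 4

lemma maxTail_gt : 791 / 1000 < maxTail := by
  have h : 4582 / 1000 < √21 := Real.lt_sqrt_of_sq_lt (by norm_num)
  unfold maxTail
  linarith

lemma maxTail_lt : maxTail < 792 / 1000 := by
  have h : √21 < 4584 / 1000 := (Real.sqrt_lt' (by norm_num)).2 (by norm_num)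
  unfold maxTail
  linarith

lemma le_maxTail_of_quadratic {x : ℝ} (hx : x ^ 2 + 3 * x ≤ 3) : x ≤ maxTail := by
  nlinarith [maxTail_sq, maxTail_gt]

lemma maxTail_le_of_quadratic {x : ℝ} (h0 : 0 ≤ x) (hx : 3 ≤ x ^ 2 + 3 * x) : maxTail ≤ x := by
  nlinarith [maxTail_sq, maxTail_gt]

lemma per13_mem_Dset : per13 ∈ Dset := by
  refine ⟨fun n => ?_, fun n => ?_⟩
  · unfold per13
    split_ifs <;> simp
  · unfold per13
    split_ifs <;> simp [badPairs]

lemma per31_mem_Dset : per31 ∈ Dset := by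
  refine ⟨fun n => ?_, fun n => ?_⟩
  · unfold per31
    split_ifs <;> simp
  · unfold per31
    split_ifs <;> simp [badPairs]

lemma per13_succ (n : ℕ) : per13 (n + 1) = per31 n := by
  unfold per13 per31
  split_ifs <;> omega

lemma per31_succ (n : ℕ) : per31 (n + 1) = per13 n := by
  unfold per13 per31
  split_ifs <;> omega

lemma cfVal_per13_eq : cfVal per13 = 1 / (1 + cfVal per31) := by
  rw [cfVal_eq (one_le_of_mem_Dset per13_mem_Dset)]
  simp only [per13_succ]
  simp [per13]

lemma cfVal_per31_eq : cfVal per31 = 1 / (3 + cfVal per13) := by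
  rw [cfVal_eq (one_le_of_mem_Dset per31_mem_Dset)]
  simp only [per31_succ]
  simp [per31]

lemma cfVal_per13 : cfVal per13 = maxTail := by
  have h0 := (cfVal_mem_Icc (one_le_of_mem_Dset per13_mem_Dset)).1
  have h1 := cfVal_per13_eq
  rw [cfVal_per31_eq] at h1
  have h2 : cfVal per13 ^ 2 + 3 * cfVal per13 = 3 := by
    field_simp at h1
    linarith
  exact le_antisymm (le_maxTail_of_quadratic h2.le) (maxTail_le_of_quadratic h0 h2.ge)

lemma one_div_three_add_maxTail : 1 / (3 + maxTail) = maxTail / 3 := by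
  have := maxTail_gt
  rw [div_eq_iff (by linarith)]
  linear_combination maxTail_sq / -3

lemma cfVal_per31 : cfVal per31 = maxTail / 3 := by
  rw [cfVal_per31_eq, cfVal_per13, one_div_three_add_maxTail]

lemma lowTails_ge_of_forall_le {X : ℝ} (hX : ∀ y ∈ fullTails, y ≤ X) {x : ℝ} (hx : x ∈ lowTails) :
    1 / (3 + X) ≤ x := by
  obtain ⟨θ, ⟨hθ, h4⟩, rfl⟩ := hx
  obtain ⟨y, hy, h⟩ := exists_eq_one_div hθ
  have hy' := tailsAfter_subset_fullTails _ hy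
  have hy0 := nonneg_of_mem_fullTails hy'
  have h1 : (1 : ℝ) ≤ θ 0 := by exact_mod_cast one_le_of_mem_Dset hθ 0
  have h3 : (θ 0 : ℝ) ≤ 3 := by
    have := hθ.1 0
    simp only [mem_insert_iff, mem_singleton_iff] at this
    exact_mod_cast (by omega : θ 0 ≤ 3)
  rw [h]
  exact one_div_le_one_div_of_le (by positivity) (add_le_add h3 (hX y hy'))

lemma le_maxTail {x : ℝ} (hx : x ∈ fullTails) : x ≤ maxTail := by
  obtain ⟨X, hXmem, hX⟩ := isCompact_fullTails.exists_isGreatest ⟨x, hx⟩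
  refine (hX hx).trans ?_
  have hX0 := nonneg_of_mem_fullTails hXmem
  obtain ⟨θ, hθ, hθX⟩ := hXmem
  obtain ⟨y, hy, h⟩ := exists_eq_one_div hθ
  have hy0 := nonneg_of_mem_fullTails (tailsAfter_subset_fullTails _ hy)
  rw [hθX] at h
  rcases (one_le_of_mem_Dset hθ 0).eq_or_lt with h1 | h1
  · rw [← h1] at h hy
    have hlow := lowTails_ge_of_forall_le (fun y hy => hX hy) (by simpa [tailsAfter] using hy)
    apply le_maxTail_of_quadratic
    have h2 : X * (1 + y) = 1 := by
      rw [h]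
      push_cast
      field_simp
    rw [div_le_iff₀ (by positivity)] at hlow
    nlinarith
  · have h2 : (2 : ℝ) ≤ θ 0 := by exact_mod_cast h1
    have h3 : X ≤ 1 / 2 := by
      rw [h]
      exact one_div_le_one_div_of_le (by norm_num) (by linarith)
    linarith [maxTail_gt]

lemma lowTails_ge {x : ℝ} (hx : x ∈ lowTails) : maxTail / 3 ≤ x := by
  rw [← one_div_three_add_maxTail]
  exact lowTails_ge_of_forall_le (fun _ => le_maxTail) hx

lemma maxTail_mem_lowTails : maxTail ∈ lowTails :=
  ⟨per13, ⟨per13_mem_Dset, by simp [per13]⟩, cfVal_per13⟩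

lemma maxTail_div_three_mem_lowTails : maxTail / 3 ∈ lowTails :=
  ⟨per31, ⟨per31_mem_Dset, by simp [per31]⟩, cfVal_per31⟩

lemma one_div_four_add_maxTail : 1 / (4 + maxTail) = 1 - maxTail := by
  have := maxTail_gt
  rw [div_eq_iff (by linarith)]
  linear_combination maxTail_sq

lemma one_sub_maxTail_mem_fullTails : 1 - maxTail ∈ fullTails := by
  rw [← one_div_four_add_maxTail]
  exact_mod_cast one_div_mem_fullTails (d := 4) (by simp)
    (by simpa [tailsAfter] using lowTails_subset_fullTails maxTail_mem_lowTails)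

lemma fullTails_ge {x : ℝ} (hx : x ∈ fullTails) : 1 - maxTail ≤ x := by
  obtain ⟨θ, hθ, rfl⟩ := hx
  obtain ⟨y, hy, h⟩ := exists_eq_one_div hθ
  have hy' := tailsAfter_subset_fullTails _ hy
  have h0 := nonneg_of_mem_fullTails hy'
  have h1 : (1 : ℝ) ≤ θ 0 := by exact_mod_cast one_le_of_mem_Dset hθ 0
  have h4 : (θ 0 : ℝ) ≤ 4 := by
    have := hθ.1 0
    simp only [mem_insert_iff, mem_singleton_iff] at this
    exact_mod_cast (by omega : θ 0 ≤ 4)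
  rw [h, ← one_div_four_add_maxTail]
  exact one_div_le_one_div_of_le (by linarith) (by linarith [le_maxTail hy'])

/-! ### Sums of Cantor sets of thickness at least one -/

/-- A family of compact sets `carrier n` with hull `[lo n, hi n]`, each of which splits into
two members of the family separated by a gap of length `gap n`, such that gaps are never longer
than the adjacent bridges and never grow along the splitting. -/
structure ThickFamily (N : Type*) where
  carrier : N → Set ℝ
  lo : N → ℝ
  hi : N → ℝ
  gap : N → ℝ
  isCompact_carrier : ∀ n, IsCompact (carrier n)
  lo_mem : ∀ n, lo n ∈ carrier n
  bound : ℝ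
  one_le_bound : 1 ≤ bound
  gap_pos : ∀ n, 0 < gap n
  length_le : ∀ n, hi n - lo n ≤ bound * gap n
  split : ∀ n, ∃ n₁ n₂, carrier n₁ ⊆ carrier n ∧ carrier n₂ ⊆ carrier n ∧
    lo n₁ = lo n ∧ hi n₂ = hi n ∧ lo n₂ = hi n₁ + gap n ∧ gap n₁ ≤ gap n ∧ gap n₂ ≤ gap n ∧
    gap n ≤ hi n₁ - lo n₁ ∧ gap n ≤ hi n₂ - lo n₂

namespace ThickFamily

variable {N : Type*} (F : ThickFamily N)

/-- `t` lies in the sum of the hulls of `n` and `m`, and the gap of each of `n`, `m` is at most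
the length of the hull of the other. -/
def Linked (t : ℝ) (n m : N) : Prop :=
  F.gap n ≤ F.hi m - F.lo m ∧ F.gap m ≤ F.hi n - F.lo n ∧
    t ∈ Icc (F.lo n + F.lo m) (F.hi n + F.hi m)

variable {F}

lemma Linked.symm {t : ℝ} {n m : N} (h : F.Linked t n m) : F.Linked t m n :=
  ⟨h.2.1, h.1, by rw [add_comm (F.lo m), add_comm (F.hi m)]; exact h.2.2⟩

lemma Linked.exists_of_gap_le {t : ℝ} {n m : N} (h : F.Linked t n m) (hg : F.gap m ≤ F.gap n) :
    ∃ n', F.Linked t n' m ∧ F.carrier n' ⊆ F.carrier n ∧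
      F.hi n' - F.lo n' ≤ (1 - 1 / F.bound) * (F.hi n - F.lo n) := by
  obtain ⟨n₁, n₂, hs₁, hs₂, hlo, hhi, hmid, hg₁, hg₂, hb₁, hb₂⟩ := F.split n
  obtain ⟨h₁, h₂, h₃, h₄⟩ := h
  have hpos := F.gap_pos n
  have hlen : 1 / F.bound * (F.hi n - F.lo n) ≤ F.gap n := by
    have hb := F.one_le_bound
    rw [one_div, inv_mul_le_iff₀ (by linarith)]
    exact F.length_le n
  rcases le_total t (F.hi n₁ + F.hi m) with ht | ht
  · exact ⟨n₁, ⟨by linarith, by linarith, by linarith, ht⟩, hs₁, by linarith⟩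
  · exact ⟨n₂, ⟨by linarith, by linarith, by linarith, by linarith⟩, hs₂, by linarith⟩

lemma Linked.length_nonneg {t : ℝ} {n m : N} (h : F.Linked t n m) : 0 ≤ F.hi n - F.lo n :=
  (F.gap_pos m).le.trans h.2.1

lemma Linked.exists_small {t : ℝ} {n m : N} (h : F.Linked t n m) (k : ℕ) :
    ∃ n' m', F.Linked t n' m' ∧ F.carrier n' ⊆ F.carrier n ∧ F.carrier m' ⊆ F.carrier m ∧
      (F.hi n' - F.lo n') * (F.hi m' - F.lo m') ≤
        (1 - 1 / F.bound) ^ k * ((F.hi n - F.lo n) * (F.hi m - F.lo m)) := by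
  have hr : 0 ≤ 1 - 1 / F.bound := by
    have hb := F.one_le_bound
    rw [sub_nonneg, div_le_one (by linarith)]
    exact hb
  induction k with
  | zero => exact ⟨n, m, h, subset_rfl, subset_rfl, by simp⟩
  | succ k ih =>
    obtain ⟨n', m', h', hn, hm, hle⟩ := ih
    have hle' := mul_le_mul_of_nonneg_left hle hr
    rcases le_total (F.gap m') (F.gap n') with hg | hg
    · obtain ⟨n'', h'', hsub, hlen⟩ := h'.exists_of_gap_le hg
      refine ⟨n'', m', h'', hsub.trans hn, hm, ?_⟩
      have := mul_le_mul_of_nonneg_right hlen h'.symm.length_nonneg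
      rw [pow_succ']
      linarith
    · obtain ⟨m'', h'', hsub, hlen⟩ := h'.symm.exists_of_gap_le hg
      refine ⟨n', m'', h''.symm, hn, hsub.trans hm, ?_⟩
      have := mul_le_mul_of_nonneg_left hlen h'.length_nonneg
      rw [pow_succ']
      linarith

lemma Linked.sq_length_le {t : ℝ} {n m : N} (h : F.Linked t n m) :
    (F.hi n - F.lo n) ^ 2 ≤ F.bound * ((F.hi n - F.lo n) * (F.hi m - F.lo m)) := by
  have h1 : F.hi n - F.lo n ≤ F.bound * (F.hi m - F.lo m) :=
    (F.length_le n).trans (mul_le_mul_of_nonneg_left h.1 (by linarith [F.one_le_bound]))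
  have := mul_le_mul_of_nonneg_left h1 h.length_nonneg
  linarith

theorem Linked.mem_add {t : ℝ} {n m : N} (h : F.Linked t n m) :
    t ∈ F.carrier n + F.carrier m := by
  have hclosed := ((F.isCompact_carrier n).add (F.isCompact_carrier m)).isClosed
  rw [← hclosed.closure_eq, Metric.mem_closure_iff]
  intro ε hε
  have hb := F.one_le_bound
  have hr : |1 - 1 / F.bound| < 1 := by
    have h1 : 1 / F.bound ≤ 1 := by rwa [div_le_one (by linarith)]
    have h2 : 0 < 1 / F.bound := by positivity
    rw [abs_lt]
    constructor <;> linarith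
  have hlim : Tendsto (fun k : ℕ => F.bound * ((1 - 1 / F.bound) ^ k *
      ((F.hi n - F.lo n) * (F.hi m - F.lo m)))) atTop (nhds 0) := by
    simpa using ((tendsto_pow_atTop_nhds_zero_of_abs_lt_one hr).mul_const
      ((F.hi n - F.lo n) * (F.hi m - F.lo m))).const_mul F.bound
  obtain ⟨k, hk⟩ := (hlim.eventually_lt_const (by positivity : 0 < (ε / 2) ^ 2)).exists
  obtain ⟨n', m', h', hn, hm, hle⟩ := h.exists_small k
  have hle' := mul_le_mul_of_nonneg_left hle (by linarith : 0 ≤ F.bound)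
  have h1 : F.hi n' - F.lo n' < ε / 2 :=
    lt_of_pow_lt_pow_left₀ 2 (by positivity) (by linarith [h'.sq_length_le])
  have h2 : F.hi m' - F.lo m' < ε / 2 :=
    lt_of_pow_lt_pow_left₀ 2 (by positivity) (by linarith [h'.symm.sq_length_le])
  refine ⟨F.lo n' + F.lo m', add_mem_add (hn (F.lo_mem n')) (hm (F.lo_mem m')), ?_⟩
  rw [Real.dist_eq, abs_of_nonneg (by linarith [h'.2.2.1])]
  linarith [h'.2.2.2]

/-- Two pairs of members whose sums of hulls overlap consecutively have an interval as sum. -/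
theorem union_add_union_eq_Icc {n₁ n₂ m₁ m₂ : N}
    (hn₁ : F.carrier n₁ ⊆ Icc (F.lo n₁) (F.hi n₁)) (hn₂ : F.carrier n₂ ⊆ Icc (F.lo n₂) (F.hi n₂))
    (hm₁ : F.carrier m₁ ⊆ Icc (F.lo m₁) (F.hi m₁)) (hm₂ : F.carrier m₂ ⊆ Icc (F.lo m₂) (F.hi m₂))
    (hgn : ∀ n, n = n₁ ∨ n = n₂ → F.gap n ≤ F.hi m₁ - F.lo m₁ ∧ F.gap n ≤ F.hi m₂ - F.lo m₂)
    (hgm : ∀ m, m = m₁ ∨ m = m₂ → F.gap m ≤ F.hi n₁ - F.lo n₁ ∧ F.gap m ≤ F.hi n₂ - F.lo n₂)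
    (hlon : F.lo n₁ ≤ F.lo n₂) (hhin : F.hi n₁ ≤ F.hi n₂)
    (hlom : F.lo m₁ ≤ F.lo m₂) (hhim : F.hi m₁ ≤ F.hi m₂)
    (h₁ : F.lo n₁ + F.lo m₂ ≤ F.hi n₁ + F.hi m₁) (h₂ : F.lo n₂ + F.lo m₁ ≤ F.hi n₁ + F.hi m₂)
    (h₃ : F.lo n₂ + F.lo m₂ ≤ F.hi n₂ + F.hi m₁) :
    (F.carrier n₁ ∪ F.carrier n₂) + (F.carrier m₁ ∪ F.carrier m₂) =
      Icc (F.lo n₁ + F.lo m₁) (F.hi n₂ + F.hi m₂) := by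
  apply Subset.antisymm
  · rintro _ ⟨x, hx, y, hy, rfl⟩
    have hx' : x ∈ Icc (F.lo n₁) (F.hi n₂) :=
      hx.elim (fun h => Icc_subset_Icc_right hhin (hn₁ h)) fun h => Icc_subset_Icc_left hlon (hn₂ h)
    have hy' : y ∈ Icc (F.lo m₁) (F.hi m₂) :=
      hy.elim (fun h => Icc_subset_Icc_right hhim (hm₁ h)) fun h => Icc_subset_Icc_left hlom (hm₂ h)
    exact ⟨add_le_add hx'.1 hy'.1, add_le_add hx'.2 hy'.2⟩
  · intro t ht
    obtain ⟨a₁, a₂⟩ := hgn n₁ (.inl rfl)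
    obtain ⟨a₃, a₄⟩ := hgn n₂ (.inr rfl)
    obtain ⟨b₁, b₂⟩ := hgm m₁ (.inl rfl)
    obtain ⟨b₃, b₄⟩ := hgm m₂ (.inr rfl)
    rcases le_total t (F.hi n₁ + F.hi m₁) with c₁ | c₁
    · have hl : F.Linked t n₁ m₁ := ⟨a₁, b₁, ht.1, c₁⟩
      exact add_subset_add subset_union_left subset_union_left hl.mem_add
    rcases le_total t (F.hi n₁ + F.hi m₂) with c₂ | c₂
    · have hl : F.Linked t n₁ m₂ := ⟨a₂, b₃, h₁.trans c₁, c₂⟩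
      exact add_subset_add subset_union_left subset_union_right hl.mem_add
    rcases le_total t (F.hi n₂ + F.hi m₁) with c₃ | c₃
    · have hl : F.Linked t n₂ m₁ := ⟨a₃, b₂, h₂.trans c₂, c₃⟩
      exact add_subset_add subset_union_right subset_union_left hl.mem_add
    · have hl : F.Linked t n₂ m₂ := ⟨a₄, b₄, h₃.trans c₃, ht.2⟩
      exact add_subset_add subset_union_right subset_union_right hl.mem_add

end ThickFamily

/-! ### Möbius maps attached to finite words -/

/-- A map `x ↦ (p + p' x) / (q + q' x)` of determinant `±1` with `0 ≤ q' ≤ q`. -/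
structure Mob where
  p : ℝ
  p' : ℝ
  q : ℝ
  q' : ℝ
  q_pos : 0 < q
  q'_nonneg : 0 ≤ q'
  q'_le : q' ≤ q
  abs_det : |p' * q - p * q'| = 1

namespace Mob

/-- The determinant, equal to `1` for increasing maps and to `-1` for decreasing ones. -/
def det (φ : Mob) : ℝ := φ.p' * φ.q - φ.p * φ.q'

/-- The value at `x`. -/
def eval (φ : Mob) (x : ℝ) : ℝ := (φ.p + φ.p' * x) / (φ.q + φ.q' * x)

/-- The length of the image of `[u, v]`. -/
def len (φ : Mob) (u v : ℝ) : ℝ := (v - u) / ((φ.q + φ.q' * u) * (φ.q + φ.q' * v))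

/-- The composition of `φ` with `x ↦ 1 / (d + x)`. -/
def digit (φ : Mob) (d : ℕ) (hd : 1 ≤ d) : Mob where
  p := d * φ.p + φ.p'
  p' := φ.p
  q := d * φ.q + φ.q'
  q' := φ.q
  q_pos := by
    have := φ.q_pos
    have := φ.q'_nonneg
    positivity
  q'_nonneg := φ.q_pos.le
  q'_le := by
    have h : (1 : ℝ) ≤ d := by exact_mod_cast hd
    nlinarith [φ.q_pos, φ.q'_nonneg]
  abs_det := by
    rw [← φ.abs_det, ← abs_neg]
    congr 1
    ring

variable (φ : Mob)

lemma denom_pos {x : ℝ} (hx : 0 ≤ x) : 0 < φ.q + φ.q' * x := by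
  have := φ.q_pos
  have := φ.q'_nonneg
  positivity

lemma eval_digit {d : ℕ} (hd : 1 ≤ d) {x : ℝ} (hx : 0 ≤ x) :
    (φ.digit d hd).eval x = φ.eval (1 / (d + x)) := by
  have h : (0 : ℝ) < d + x := by positivity
  have h1 := (φ.digit d hd).denom_pos hx
  have h2 := φ.denom_pos (by positivity : 0 ≤ 1 / (d + x))
  simp only [eval, digit] at *
  rw [div_eq_div_iff h1.ne' h2.ne']
  field_simp
  ring

lemma det_digit {d : ℕ} (hd : 1 ≤ d) : (φ.digit d hd).det = -φ.det := by
  simp only [det, digit]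
  ring

lemma eval_sub_eval {x y : ℝ} (hx : 0 ≤ x) (hy : 0 ≤ y) :
    φ.eval y - φ.eval x = φ.det * φ.len x y := by
  have h1 := (φ.denom_pos hx).ne'
  have h2 := (φ.denom_pos hy).ne'
  simp only [eval, det, len]
  rw [div_sub_div _ _ h2 h1, ← mul_div_assoc, div_eq_div_iff (by positivity) (by positivity)]
  ring

lemma len_pos {x y : ℝ} (hx : 0 ≤ x) (hxy : x < y) : 0 < φ.len x y :=
  div_pos (sub_pos.2 hxy) (mul_pos (φ.denom_pos hx) (φ.denom_pos (hx.trans hxy.le)))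

lemma len_nonneg {x y : ℝ} (hx : 0 ≤ x) (hxy : x ≤ y) : 0 ≤ φ.len x y :=
  div_nonneg (sub_nonneg.2 hxy) (mul_pos (φ.denom_pos hx) (φ.denom_pos (hx.trans hxy))).le

lemma len_digit {d : ℕ} (hd : 1 ≤ d) {x y : ℝ} (hx : 0 ≤ x) (hy : 0 ≤ y) :
    (φ.digit d hd).len x y = φ.len (1 / (d + y)) (1 / (d + x)) := by
  have h1 : (0 : ℝ) < d + x := by positivity
  have h2 : (0 : ℝ) < d + y := by positivity
  have h3 := (φ.digit d hd).denom_pos hx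
  have h4 := (φ.digit d hd).denom_pos hy
  have h5 := φ.denom_pos (by positivity : 0 ≤ 1 / (d + x))
  have h6 := φ.denom_pos (by positivity : 0 ≤ 1 / (d + y))
  simp only [len, digit] at *
  rw [div_eq_div_iff (mul_pos h3 h4).ne' (mul_pos h6 h5).ne']
  field_simp
  ring

lemma det_eq_one_or : φ.det = 1 ∨ φ.det = -1 := eq_or_eq_neg_of_abs_eq φ.abs_det

lemma max_eval_sub_min_eval {x y : ℝ} (hx : 0 ≤ x) (hxy : x ≤ y) :
    max (φ.eval x) (φ.eval y) - min (φ.eval x) (φ.eval y) = φ.len x y := by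
  have h := φ.eval_sub_eval hx (hx.trans hxy)
  have h0 := φ.len_nonneg hx hxy
  rw [max_sub_min_eq_abs, h, abs_mul, abs_of_nonneg h0, det, φ.abs_det, one_mul]

end Mob

/-- Comparison of two quotients whose denominators are products of two linear forms in `Q`, `R`
with nonnegative values, by comparison of the coefficients after clearing denominators. -/
lemma div_mul_le_div_mul_of_coeff {m n x₁ y₁ x₂ y₂ z₁ w₁ z₂ w₂ Q R : ℝ} (hQ : 0 ≤ Q) (hR : 0 ≤ R)
    (h₁ : 0 < (x₁ * Q + y₁ * R) * (x₂ * Q + y₂ * R))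
    (h₂ : 0 < (z₁ * Q + w₁ * R) * (z₂ * Q + w₂ * R))
    (hQQ : m * (z₁ * z₂) ≤ n * (x₁ * x₂))
    (hQR : m * (z₁ * w₂ + w₁ * z₂) ≤ n * (x₁ * y₂ + y₁ * x₂))
    (hRR : m * (w₁ * w₂) ≤ n * (y₁ * y₂)) :
    m / ((x₁ * Q + y₁ * R) * (x₂ * Q + y₂ * R)) ≤ n / ((z₁ * Q + w₁ * R) * (z₂ * Q + w₂ * R)) := by
  rw [div_le_div_iff₀ h₁ h₂]
  have e₁ := mul_le_mul_of_nonneg_right hQQ (mul_nonneg hQ hQ)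
  have e₂ := mul_le_mul_of_nonneg_right hQR (mul_nonneg hQ hR)
  have e₃ := mul_le_mul_of_nonneg_right hRR (mul_nonneg hR hR)
  linarith

lemma Mob.len_le_mul_len (φ : Mob) {c u v x y : ℝ} (hu : 0 ≤ u) (hv : 0 ≤ v) (hx : 0 ≤ x)
    (hy : 0 ≤ y) (h₀ : v - u ≤ c * (y - x))
    (h₁ : (v - u) * (2 + x + y) ≤ c * (y - x) * (2 + u + v))
    (h₂ : (v - u) * ((1 + x) * (1 + y)) ≤ c * (y - x) * ((1 + u) * (1 + v))) :
    φ.len u v ≤ c * φ.len x y := by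
  have e : ∀ z, φ.q + φ.q' * z = 1 * (φ.q - φ.q') + (1 + z) * φ.q' := fun z => by ring
  have hu' := φ.denom_pos hu
  have hv' := φ.denom_pos hv
  have hx' := φ.denom_pos hx
  have hy' := φ.denom_pos hy
  unfold Mob.len
  rw [← mul_div_assoc]
  simp only [e] at *
  exact div_mul_le_div_mul_of_coeff (sub_nonneg.2 φ.q'_le) φ.q'_nonneg (mul_pos hu' hv')
    (mul_pos hx' hy') (by linarith) (by linarith) h₂

lemma Mob.len_le_len (φ : Mob) {u v x y : ℝ} (hu : 0 ≤ u) (hv : 0 ≤ v) (hx : 0 ≤ x)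
    (hy : 0 ≤ y) (h₀ : v - u ≤ y - x) (h₁ : (v - u) * (2 + x + y) ≤ (y - x) * (2 + u + v))
    (h₂ : (v - u) * ((1 + x) * (1 + y)) ≤ (y - x) * ((1 + u) * (1 + v))) :
    φ.len u v ≤ φ.len x y := by
  simpa using φ.len_le_mul_len (c := 1) hu hv hx hy (by simpa using h₀) (by simpa using h₁)
    (by simpa using h₂)

/-! ### The splitting of the tail sets -/

/-- The values of the tails whose first partial quotient lies in `s`. -/
def digitTails (s : Finset ℕ) : Set ℝ :=
  ⋃ d ∈ s, (fun x : ℝ => 1 / (d + x)) '' tailsAfter d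

lemma mem_digitTails {s : Finset ℕ} {y : ℝ} :
    y ∈ digitTails s ↔ ∃ d ∈ s, ∃ x ∈ tailsAfter d, 1 / (d + x) = y := by
  simp [digitTails]

lemma isCompact_tailsAfter (d : ℕ) : IsCompact (tailsAfter d) := by
  unfold tailsAfter
  split_ifs
  exacts [isCompact_lowTails, isCompact_fullTails]

lemma nonneg_of_mem_tailsAfter {d : ℕ} {x : ℝ} (hx : x ∈ tailsAfter d) : 0 ≤ x :=
  nonneg_of_mem_fullTails (tailsAfter_subset_fullTails d hx)

lemma isCompact_digitTails {s : Finset ℕ} (hs : ∀ d ∈ s, 1 ≤ d) : IsCompact (digitTails s) := by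
  refine s.isCompact_biUnion fun d hd => (isCompact_tailsAfter d).image_of_continuousOn ?_
  refine continuousOn_const.div (continuousOn_const.add continuousOn_id) fun x hx => ?_
  have h1 : (1 : ℝ) ≤ d := by exact_mod_cast hs d hd
  have := nonneg_of_mem_tailsAfter hx
  positivity

lemma digitTails_mono {s t : Finset ℕ} (h : s ⊆ t) : digitTails s ⊆ digitTails t :=
  biUnion_subset_biUnion_left h

lemma fullTails_eq : fullTails = digitTails {1, 2, 3, 4} := by
  ext y
  rw [mem_digitTails]
  constructor
  · rintro ⟨θ, hθ, rfl⟩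
    obtain ⟨x, hx, h⟩ := exists_eq_one_div hθ
    exact ⟨θ 0, by simpa using hθ.1 0, x, hx, h.symm⟩
  · rintro ⟨d, hd, x, hx, rfl⟩
    exact one_div_mem_fullTails (by simpa using hd) hx

lemma lowTails_eq : lowTails = digitTails {1, 2, 3} := by
  ext y
  rw [mem_digitTails]
  constructor
  · rintro ⟨θ, ⟨hθ, h4⟩, rfl⟩
    obtain ⟨x, hx, h⟩ := exists_eq_one_div hθ
    refine ⟨θ 0, ?_, x, hx, h.symm⟩
    have := hθ.1 0
    simp only [mem_insert_iff, mem_singleton_iff] at this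
    simp only [Finset.mem_insert, Finset.mem_singleton]
    omega
  · rintro ⟨d, hd, x, hx, rfl⟩
    exact one_div_mem_lowTails (by simpa using hd) hx

/-- The shapes of the pieces met when the tail sets are split repeatedly. -/
inductive Shape
  | low
  | low23
  | full
  | full234
  | full34

namespace Shape

/-- The first partial quotients of a piece. -/
def digits : Shape → Finset ℕ
  | low => {1, 2, 3}
  | low23 => {2, 3}
  | full => {1, 2, 3, 4}
  | full234 => {2, 3, 4}
  | full34 => {3, 4}

/-- The minimum of a piece. -/
def left : Shape → ℝ
  | low | low23 => maxTail / 3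
  | full | full234 | full34 => 1 - maxTail

/-- The maximum of a piece. -/
def right : Shape → ℝ
  | low | full => maxTail
  | low23 | full234 => (3 - maxTail) / 5
  | full34 => (7 + maxTail) / 25

/-- The left end of the gap at which a piece is split. -/
def gapL : Shape → ℝ
  | low | full => (3 - maxTail) / 5
  | low23 | full234 => (7 + maxTail) / 25
  | full34 => (8 + maxTail) / 37

/-- The right end of the gap at which a piece is split. -/
def gapR : Shape → ℝ
  | low | full => (2 + maxTail) / 5
  | low23 | full234 => (1 + maxTail) / 5
  | full34 => maxTail / 3

/-- The shape of the set of tails after the partial quotient `d`. -/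
def after (d : ℕ) : Shape := if d ≤ 2 then low else full

lemma digitTails_digits_after (d : ℕ) : digitTails (after d).digits = tailsAfter d := by
  unfold after tailsAfter
  split_ifs
  exacts [lowTails_eq.symm, fullTails_eq.symm]

lemma one_le_of_mem_digits {k : Shape} {d : ℕ} (hd : d ∈ k.digits) : 1 ≤ d := by
  cases k <;> simp only [digits, Finset.mem_insert, Finset.mem_singleton] at hd <;> omega

lemma order (k : Shape) : 0 < k.left ∧ k.left < k.gapL ∧ k.gapL < k.gapR ∧ k.gapR < k.right := by
  have := maxTail_gt
  have := maxTail_lt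
  cases k <;> refine ⟨?_, ?_, ?_, ?_⟩ <;> simp only [left, right, gapL, gapR] <;> linarith

lemma left_nonneg (k : Shape) : 0 ≤ k.left := k.order.1.le

lemma gapL_nonneg (k : Shape) : 0 ≤ k.gapL := by linarith [k.order]

lemma gapR_nonneg (k : Shape) : 0 ≤ k.gapR := by linarith [k.order]

lemma right_nonneg (k : Shape) : 0 ≤ k.right := by linarith [k.order]

lemma left_le_right (k : Shape) : k.left ≤ k.right := by linarith [k.order]

lemma one_div_eq {a b : ℝ} (h : a * b = 1) : 1 / a = b := (eq_one_div_of_mul_eq_one_right h).symm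

/-- The inversion `x ↦ 1 / (d + x)` maps the hull of the set of tails after `d` onto `[u, v]` and
the gap of this set onto `(a, b)`. -/
structure Inverts (d : ℕ) (u v a b : ℝ) : Prop where
  right : 1 / (d + (after d).right) = u
  left : 1 / (d + (after d).left) = v
  gapR : 1 / (d + (after d).gapR) = a
  gapL : 1 / (d + (after d).gapL) = b

lemma inverts_one :
    Inverts 1 ((2 + maxTail) / 5) maxTail ((4 - maxTail) / 5) ((11 + maxTail) / 17) := by
  have h := maxTail_sq
  constructor <;> refine one_div_eq ?_ <;>
    norm_num [after, Shape.left, Shape.right, Shape.gapL, Shape.gapR] <;> linarith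

lemma inverts_two :
    Inverts 2 ((1 + maxTail) / 5) ((3 - maxTail) / 5) ((9 - maxTail) / 21)
      ((16 + maxTail) / 41) := by
  have h := maxTail_sq
  constructor <;> refine one_div_eq ?_ <;>
    norm_num [after, Shape.left, Shape.right, Shape.gapL, Shape.gapR] <;> linarith

lemma inverts_three :
    Inverts 3 (maxTail / 3) ((7 + maxTail) / 25) ((14 - maxTail) / 47) ((21 + maxTail) / 75) := by
  have h := maxTail_sq
  constructor <;> refine one_div_eq ?_ <;>
    norm_num [after, Shape.left, Shape.right, Shape.gapL, Shape.gapR] <;> linarith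

lemma inverts_four :
    Inverts 4 (1 - maxTail) ((8 + maxTail) / 37) ((19 - maxTail) / 83) ((26 + maxTail) / 119) := by
  have h := maxTail_sq
  constructor <;> refine one_div_eq ?_ <;>
    norm_num [after, Shape.left, Shape.right, Shape.gapL, Shape.gapR] <;> linarith

lemma left_mem (k : Shape) : k.left ∈ digitTails k.digits := by
  have h := maxTail_sq
  have hM := maxTail_mem_lowTails
  have hM' := lowTails_subset_fullTails hM
  rw [mem_digitTails]
  cases k
  case low | low23 =>
    refine ⟨3, by simp [digits], maxTail, by simpa [tailsAfter] using hM', one_div_eq ?_⟩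
    simp only [left]
    push_cast
    linear_combination h / 3
  all_goals
    refine ⟨4, by simp [digits], maxTail, by simpa [tailsAfter] using hM', one_div_eq ?_⟩
    simp only [left]
    push_cast
    linear_combination -h

lemma right_mem (k : Shape) : k.right ∈ digitTails k.digits := by
  have h := maxTail_sq
  have hm := maxTail_div_three_mem_lowTails
  have hm' := one_sub_maxTail_mem_fullTails
  rw [mem_digitTails]
  cases k
  case low | full =>
    refine ⟨1, by simp [digits], maxTail / 3, by simpa [tailsAfter] using hm, one_div_eq ?_⟩
    simp only [right]
    push_cast
    linear_combination h / 3
  case low23 | full234 =>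
    refine ⟨2, by simp [digits], maxTail / 3, by simpa [tailsAfter] using hm, one_div_eq ?_⟩
    simp only [right]
    push_cast
    linear_combination -h / 15
  case full34 =>
    refine ⟨3, by simp [digits], 1 - maxTail, by simpa [tailsAfter] using hm', one_div_eq ?_⟩
    simp only [right]
    push_cast
    linear_combination -h / 25

end Shape

/-! ### Cells -/

/-- The image of a piece under the Möbius map of a finite word. -/
abbrev Cell := Mob × Shape

namespace Cell

/-- The points of a cell. -/
def carrier (n : Cell) : Set ℝ := n.1.eval '' digitTails n.2.digits

/-- The minimum of a cell. -/
def lo (n : Cell) : ℝ := min (n.1.eval n.2.left) (n.1.eval n.2.right)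

/-- The maximum of a cell. -/
def hi (n : Cell) : ℝ := max (n.1.eval n.2.left) (n.1.eval n.2.right)

/-- The length of the gap at which a cell is split. -/
def gap (n : Cell) : ℝ := n.1.len n.2.gapL n.2.gapR

lemma hi_sub_lo (n : Cell) : n.hi - n.lo = n.1.len n.2.left n.2.right :=
  n.1.max_eval_sub_min_eval n.2.left_nonneg n.2.left_le_right

lemma isCompact_carrier (n : Cell) : IsCompact n.carrier := by
  refine (isCompact_digitTails fun d => Shape.one_le_of_mem_digits).image_of_continuousOn ?_
  refine ContinuousOn.div (by fun_prop) (by fun_prop) fun x hx => (n.1.denom_pos ?_).ne'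
  obtain ⟨d, -, y, hy, rfl⟩ := mem_digitTails.1 hx
  have := nonneg_of_mem_tailsAfter hy
  positivity

lemma lo_mem (n : Cell) : n.lo ∈ n.carrier := by
  rcases min_choice (n.1.eval n.2.left) (n.1.eval n.2.right) with h | h
  · exact ⟨_, n.2.left_mem, h.symm⟩
  · exact ⟨_, n.2.right_mem, h.symm⟩

/-- `n'` is the part of the cell `n` over `[u, v]`, it is at least as long as the gap of `n`,
and its own gap is at most that of `n`. -/
structure IsPart (n' n : Cell) (u v : ℝ) : Prop where
  carrier_subset : n'.carrier ⊆ n.carrier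
  lo_eq : n'.lo = min (n.1.eval u) (n.1.eval v)
  hi_eq : n'.hi = max (n.1.eval u) (n.1.eval v)
  gap_le : n'.gap ≤ n.gap
  gap_le_len : n.gap ≤ n.1.len u v

lemma isPart_of_shape {φ : Mob} {k k' : Shape} (h : k'.digits ⊆ k.digits)
    (hgap : φ.len k'.gapL k'.gapR ≤ φ.len k.gapL k.gapR)
    (hlen : φ.len k.gapL k.gapR ≤ φ.len k'.left k'.right) :
    IsPart (φ, k') (φ, k) k'.left k'.right :=
  ⟨image_mono (digitTails_mono h), rfl, rfl, hgap, hlen⟩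

lemma isPart_digit {φ : Mob} {k : Shape} {d : ℕ} (hd : 1 ≤ d) (hdk : d ∈ k.digits) {u v a b : ℝ}
    (h : Shape.Inverts d u v a b) (hgap : φ.len a b ≤ φ.len k.gapL k.gapR)
    (hlen : φ.len k.gapL k.gapR ≤ φ.len u v) :
    IsPart (φ.digit d hd, Shape.after d) (φ, k) u v where
  carrier_subset := by
    rintro _ ⟨x, hx, rfl⟩
    simp only [Shape.digitTails_digits_after] at hx
    rw [φ.eval_digit hd (nonneg_of_mem_tailsAfter hx)]
    exact ⟨_, mem_digitTails.2 ⟨d, hdk, x, hx, rfl⟩, rfl⟩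
  lo_eq := by
    simp only [lo, φ.eval_digit hd (Shape.left_nonneg _), φ.eval_digit hd (Shape.right_nonneg _),
      h.right, h.left, min_comm]
  hi_eq := by
    simp only [hi, φ.eval_digit hd (Shape.left_nonneg _), φ.eval_digit hd (Shape.right_nonneg _),
      h.right, h.left, max_comm]
  gap_le := by
    simp only [gap, φ.len_digit hd (Shape.gapL_nonneg _) (Shape.gapR_nonneg _),
      h.gapR, h.gapL]
    exact hgap
  gap_le_len := hlen

end Cell

lemma maxTail_cube : maxTail ^ 3 = 12 * maxTail - 9 := by
  linear_combination (maxTail - 3) * maxTail_sq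

namespace Cell

lemma gap_le_left (n : Cell) : n.gap ≤ n.1.len n.2.left n.2.gapL := by
  have h1 := maxTail_sq
  have h2 := maxTail_cube
  have h3 := maxTail_gt
  have h4 := maxTail_lt
  obtain ⟨φ, k⟩ := n
  refine φ.len_le_len k.gapL_nonneg k.gapR_nonneg k.left_nonneg k.gapL_nonneg ?_ ?_ ?_ <;>
    cases k <;> simp only [Shape.left, Shape.gapL, Shape.gapR] <;> nlinarith

lemma gap_le_right (n : Cell) : n.gap ≤ n.1.len n.2.gapR n.2.right := by
  have h1 := maxTail_sq
  have h2 := maxTail_cube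
  have h3 := maxTail_gt
  have h4 := maxTail_lt
  obtain ⟨φ, k⟩ := n
  refine φ.len_le_len k.gapL_nonneg k.gapR_nonneg k.gapR_nonneg k.right_nonneg ?_ ?_ ?_ <;>
    cases k <;> simp only [Shape.right, Shape.gapL, Shape.gapR] <;> nlinarith

lemma hi_sub_lo_le (n : Cell) : n.hi - n.lo ≤ 20 * n.gap := by
  have h1 := maxTail_sq
  have h2 := maxTail_cube
  have h3 := maxTail_gt
  have h4 := maxTail_lt
  rw [hi_sub_lo]
  obtain ⟨φ, k⟩ := n
  refine φ.len_le_mul_len k.left_nonneg k.right_nonneg k.gapL_nonneg k.gapR_nonneg ?_ ?_ ?_ <;>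
    cases k <;> simp only [Shape.left, Shape.right, Shape.gapL, Shape.gapR] <;> nlinarith

lemma exists_isPart_one {φ : Mob} {k : Shape} (hk : 1 ∈ k.digits)
    (hgap : φ.len ((4 - maxTail) / 5) ((11 + maxTail) / 17) ≤ φ.len k.gapL k.gapR)
    (hlen : φ.len k.gapL k.gapR ≤ φ.len ((2 + maxTail) / 5) maxTail) :
    ∃ n', IsPart n' (φ, k) ((2 + maxTail) / 5) maxTail :=
  ⟨_, isPart_digit le_rfl hk Shape.inverts_one hgap hlen⟩

lemma exists_isPart_two {φ : Mob} {k : Shape} (hk : 2 ∈ k.digits)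
    (hgap : φ.len ((9 - maxTail) / 21) ((16 + maxTail) / 41) ≤ φ.len k.gapL k.gapR)
    (hlen : φ.len k.gapL k.gapR ≤ φ.len ((1 + maxTail) / 5) ((3 - maxTail) / 5)) :
    ∃ n', IsPart n' (φ, k) ((1 + maxTail) / 5) ((3 - maxTail) / 5) :=
  ⟨_, isPart_digit one_le_two hk Shape.inverts_two hgap hlen⟩

lemma exists_isPart_three {φ : Mob} {k : Shape} (hk : 3 ∈ k.digits)
    (hgap : φ.len ((14 - maxTail) / 47) ((21 + maxTail) / 75) ≤ φ.len k.gapL k.gapR)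
    (hlen : φ.len k.gapL k.gapR ≤ φ.len (maxTail / 3) ((7 + maxTail) / 25)) :
    ∃ n', IsPart n' (φ, k) (maxTail / 3) ((7 + maxTail) / 25) :=
  ⟨_, isPart_digit (by norm_num) hk Shape.inverts_three hgap hlen⟩

lemma exists_isPart_four {φ : Mob} {k : Shape} (hk : 4 ∈ k.digits)
    (hgap : φ.len ((19 - maxTail) / 83) ((26 + maxTail) / 119) ≤ φ.len k.gapL k.gapR)
    (hlen : φ.len k.gapL k.gapR ≤ φ.len (1 - maxTail) ((8 + maxTail) / 37)) :
    ∃ n', IsPart n' (φ, k) (1 - maxTail) ((8 + maxTail) / 37) :=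
  ⟨_, isPart_digit (by norm_num) hk Shape.inverts_four hgap hlen⟩

lemma exists_isPart_left (n : Cell) : ∃ n', IsPart n' n n.2.left n.2.gapL := by
  have h1 := maxTail_sq
  have h2 := maxTail_cube
  have h3 := maxTail_gt
  have h4 := maxTail_lt
  have hlen := n.gap_le_left
  obtain ⟨φ, k⟩ := n
  cases k
  case low =>
    refine ⟨_, isPart_of_shape (k' := .low23) (by decide) ?_ hlen⟩
    apply φ.len_le_len <;> simp only [Shape.gapL, Shape.gapR] <;> nlinarith
  case low23 =>
    refine exists_isPart_three (by decide) ?_ hlen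
    apply φ.len_le_len <;> simp -failIfUnchanged only [Shape.gapL, Shape.gapR] <;> nlinarith
  case full =>
    refine ⟨_, isPart_of_shape (k' := .full234) (by decide) ?_ hlen⟩
    apply φ.len_le_len <;> simp only [Shape.gapL, Shape.gapR] <;> nlinarith
  case full234 =>
    refine ⟨_, isPart_of_shape (k' := .full34) (by decide) ?_ hlen⟩
    apply φ.len_le_len <;> simp only [Shape.gapL, Shape.gapR] <;> nlinarith
  case full34 =>
    refine exists_isPart_four (by decide) ?_ hlen
    apply φ.len_le_len <;> simp -failIfUnchanged only [Shape.gapL, Shape.gapR] <;> nlinarith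

lemma exists_isPart_right (n : Cell) : ∃ n', IsPart n' n n.2.gapR n.2.right := by
  have h1 := maxTail_sq
  have h2 := maxTail_cube
  have h3 := maxTail_gt
  have h4 := maxTail_lt
  have hlen := n.gap_le_right
  obtain ⟨φ, k⟩ := n
  cases k
  case low | full =>
    refine exists_isPart_one (by decide) ?_ hlen
    apply φ.len_le_len <;> simp -failIfUnchanged only [Shape.gapL, Shape.gapR] <;> nlinarith
  case low23 | full234 =>
    refine exists_isPart_two (by decide) ?_ hlen
    apply φ.len_le_len <;> simp -failIfUnchanged only [Shape.gapL, Shape.gapR] <;> nlinarith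
  case full34 =>
    refine exists_isPart_three (by decide) ?_ hlen
    apply φ.len_le_len <;> simp -failIfUnchanged only [Shape.gapL, Shape.gapR] <;> nlinarith

lemma exists_split (n : Cell) : ∃ n₁ n₂ : Cell, n₁.carrier ⊆ n.carrier ∧ n₂.carrier ⊆ n.carrier ∧
    n₁.lo = n.lo ∧ n₂.hi = n.hi ∧ n₂.lo = n₁.hi + n.gap ∧ n₁.gap ≤ n.gap ∧ n₂.gap ≤ n.gap ∧
    n.gap ≤ n₁.hi - n₁.lo ∧ n.gap ≤ n₂.hi - n₂.lo := by
  obtain ⟨n₁, h₁⟩ := n.exists_isPart_left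
  obtain ⟨n₂, h₂⟩ := n.exists_isPart_right
  have hgap : n.gap = n.1.len n.2.gapL n.2.gapR := rfl
  have e₁ := n.1.eval_sub_eval n.2.left_nonneg n.2.gapL_nonneg
  have e₂ := n.1.eval_sub_eval n.2.gapL_nonneg n.2.gapR_nonneg
  have e₃ := n.1.eval_sub_eval n.2.gapR_nonneg n.2.right_nonneg
  have l₁ := n.1.len_pos n.2.left_nonneg n.2.order.2.1
  have l₂ := n.1.len_pos n.2.gapL_nonneg n.2.order.2.2.1
  have l₃ := n.1.len_pos n.2.gapR_nonneg n.2.order.2.2.2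
  have g₁ := h₁.gap_le_len
  have g₂ := h₂.gap_le_len
  have r₁ := h₁.lo_eq
  have r₂ := h₁.hi_eq
  have r₃ := h₂.lo_eq
  have r₄ := h₂.hi_eq
  have s₁ : n.lo = min _ _ := rfl
  have s₂ : n.hi = max _ _ := rfl
  rcases n.1.det_eq_one_or with hd | hd <;> rw [hd] at e₁ e₂ e₃
  · rw [min_eq_left (by linarith)] at r₁ r₃ s₁
    rw [max_eq_right (by linarith)] at r₂ r₄ s₂
    refine ⟨n₁, n₂, h₁.carrier_subset, h₂.carrier_subset, ?_, ?_, ?_, h₁.gap_le, h₂.gap_le,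
      ?_, ?_⟩ <;> linarith
  · rw [min_eq_right (by linarith)] at r₁ r₃ s₁
    rw [max_eq_left (by linarith)] at r₂ r₄ s₂
    refine ⟨n₂, n₁, h₂.carrier_subset, h₁.carrier_subset, ?_, ?_, ?_, h₂.gap_le, h₁.gap_le,
      ?_, ?_⟩ <;> linarith

/-- The cells form a family of thickness at least one. -/
def thickFamily : ThickFamily Cell where
  carrier := carrier
  lo := lo
  hi := hi
  gap := gap
  isCompact_carrier := isCompact_carrier
  lo_mem := lo_mem
  bound := 20
  one_le_bound := by norm_num
  gap_pos n := n.1.len_pos n.2.gapL_nonneg n.2.order.2.2.1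
  length_le := hi_sub_lo_le
  split := exists_split

end Cell

/-! ### The words `b^s` and `c^s` -/

/-- The Möbius map `φ` is the map `x ↦ [0; w₁, …, w_k + x]`. -/
def Mob.Represents (φ : Mob) (w : List ℕ) : Prop := ∀ x, 0 ≤ x → cfWord w x = φ.eval x

lemma Mob.Represents.digit {φ : Mob} {w : List ℕ} (h : φ.Represents w) {d : ℕ} (hd : 1 ≤ d) :
    (φ.digit d hd).Represents (w ++ [d]) := by
  intro x hx
  rw [cfWord_append, φ.eval_digit hd hx, ← h (1 / (d + x)) (by positivity)]
  rfl

lemma Mob.Represents.Kb_eq {φ : Mob} {w : List ℕ} (h : φ.Represents w) (hw : ∀ e ∈ w, 1 ≤ e)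
    {d : ℕ} (hd : d ∈ ({1, 2, 3, 4} : Set ℕ)) (hd1 : 1 ≤ d) :
    Kb (w ++ [d]) = Cell.carrier (φ.digit d hd1, Shape.after d) := by
  rw [Kb_append_singleton hw hd, Cell.carrier, Shape.digitTails_digits_after]
  refine image_congr fun x hx => ?_
  have hx0 := nonneg_of_mem_tailsAfter hx
  rw [φ.eval_digit hd1 hx0, ← h (1 / (d + x)) (by positivity)]

lemma Mob.Represents.cfVal_app {φ : Mob} {w : List ℕ} (h : φ.Represents w)
    (hw : ∀ e ∈ w, 1 ≤ e) {θ : ℕ → ℕ} (hθ : θ ∈ Dset) :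
    cfVal (app w θ) = φ.eval (cfVal θ) := by
  rw [_root_.cfVal_app hw (one_le_of_mem_Dset hθ)]
  exact h _ (cfVal_mem_Icc (one_le_of_mem_Dset hθ)).1

lemma bW_succ (k : ℕ) : bW (k + 1) = bW k ++ [1] ++ [4] := by
  simp [bW, List.replicate_succ']

lemma one_le_of_mem_bW {k e : ℕ} (he : e ∈ bW k) : 1 ≤ e := by
  simp only [bW, List.mem_flatten, List.mem_replicate] at he
  obtain ⟨l, ⟨-, rfl⟩, he⟩ := he
  simp only [List.mem_cons, List.not_mem_nil, or_false] at he
  omega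

lemma exists_represents_bW (k : ℕ) : ∃ φ : Mob, φ.Represents (bW k) ∧ φ.det = 1 := by
  induction k with
  | zero =>
    refine ⟨⟨0, 1, 1, 0, one_pos, le_rfl, zero_le_one, by norm_num⟩, fun x _ => ?_, ?_⟩
    · simp [cfWord, bW, Mob.eval]
    · simp [Mob.det]
  | succ k ih =>
    obtain ⟨φ, h, hdet⟩ := ih
    rw [bW_succ]
    exact ⟨_, (h.digit le_rfl).digit (by norm_num), by simp [Mob.det_digit, hdet]⟩

/-! ### The first splitting -/

namespace Mob

variable (φ : Mob)

/-- The map of the word of `φ` followed by `1, 4, 1`. -/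
def ext141 : Mob := ((φ.digit 1 le_rfl).digit 4 (by norm_num)).digit 1 le_rfl

/-- The map of the word of `φ` followed by `1, 3, 1`. -/
def ext131 : Mob := ((φ.digit 1 le_rfl).digit 3 (by norm_num)).digit 1 le_rfl

lemma ext141_denom (x : ℝ) :
    φ.ext141.q + φ.ext141.q' * x = (6 + 5 * x) * φ.q + (5 + 4 * x) * φ.q' := by
  simp only [ext141, digit]
  push_cast
  ring

lemma ext131_denom (x : ℝ) :
    φ.ext131.q + φ.ext131.q' * x = (5 + 4 * x) * φ.q + (4 + 3 * x) * φ.q' := by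
  simp only [ext131, digit]
  push_cast
  ring

lemma len_ext141_le_len_ext131 {u v x y : ℝ} (hu : 0 ≤ u) (hv : 0 ≤ v) (hx : 0 ≤ x) (hy : 0 ≤ y)
    (h₀ : (v - u) * ((5 + 4 * x) * (5 + 4 * y)) ≤ (y - x) * ((6 + 5 * u) * (6 + 5 * v)))
    (h₁ : (v - u) * ((5 + 4 * x) * (4 + 3 * y) + (4 + 3 * x) * (5 + 4 * y)) ≤
      (y - x) * ((6 + 5 * u) * (5 + 4 * v) + (5 + 4 * u) * (6 + 5 * v)))
    (h₂ : (v - u) * ((4 + 3 * x) * (4 + 3 * y)) ≤ (y - x) * ((5 + 4 * u) * (5 + 4 * v))) :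
    φ.ext141.len u v ≤ φ.ext131.len x y := by
  have hu' := φ.ext141.denom_pos hu
  have hv' := φ.ext141.denom_pos hv
  have hx' := φ.ext131.denom_pos hx
  have hy' := φ.ext131.denom_pos hy
  unfold len
  simp only [ext141_denom, ext131_denom] at *
  exact div_mul_le_div_mul_of_coeff φ.q_pos.le φ.q'_nonneg (mul_pos hu' hv') (mul_pos hx' hy')
    h₀ h₁ h₂

lemma len_ext131_le_len_ext141 {u v x y : ℝ} (hu : 0 ≤ u) (hv : 0 ≤ v) (hx : 0 ≤ x) (hy : 0 ≤ y)
    (h₀ : (v - u) * ((6 + 5 * x) * (6 + 5 * y)) ≤ (y - x) * ((5 + 4 * u) * (5 + 4 * v)))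
    (h₁ : (v - u) * ((6 + 5 * x) * (5 + 4 * y) + (5 + 4 * x) * (6 + 5 * y)) ≤
      (y - x) * ((5 + 4 * u) * (4 + 3 * v) + (4 + 3 * u) * (5 + 4 * v)))
    (h₂ : (v - u) * ((5 + 4 * x) * (5 + 4 * y)) ≤ (y - x) * ((4 + 3 * u) * (4 + 3 * v))) :
    φ.ext131.len u v ≤ φ.ext141.len x y := by
  have hu' := φ.ext131.denom_pos hu
  have hv' := φ.ext131.denom_pos hv
  have hx' := φ.ext141.denom_pos hx
  have hy' := φ.ext141.denom_pos hy
  unfold len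
  simp only [ext141_denom, ext131_denom] at *
  exact div_mul_le_div_mul_of_coeff φ.q_pos.le φ.q'_nonneg (mul_pos hu' hv') (mul_pos hx' hy')
    h₀ h₁ h₂

end Mob

namespace Cell

variable {φ : Mob}

lemma lo_eq_of_det {k : Shape} (h : φ.det = 1) : lo (φ, k) = φ.eval k.left := by
  have := φ.eval_sub_eval k.left_nonneg k.right_nonneg
  have := φ.len_nonneg k.left_nonneg k.left_le_right
  exact min_eq_left (by rw [h] at *; linarith)

lemma hi_eq_of_det {k : Shape} (h : φ.det = 1) : hi (φ, k) = φ.eval k.right := by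
  have := φ.eval_sub_eval k.left_nonneg k.right_nonneg
  have := φ.len_nonneg k.left_nonneg k.left_le_right
  exact max_eq_right (by rw [h] at *; linarith)

lemma carrier_subset_Icc {d : ℕ} (h : φ.det = 1) :
    carrier (φ, Shape.after d) ⊆ Icc (lo (φ, Shape.after d)) (hi (φ, Shape.after d)) := by
  rintro _ ⟨x, hx, rfl⟩
  rw [lo_eq_of_det h, hi_eq_of_det h]
  simp only [Shape.digitTails_digits_after] at hx ⊢
  have hx0 := nonneg_of_mem_tailsAfter hx
  have hbd : (Shape.after d).left ≤ x ∧ x ≤ (Shape.after d).right := by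
    unfold Shape.after tailsAfter at *
    split_ifs at *
    · exact ⟨lowTails_ge hx, le_maxTail (lowTails_subset_fullTails hx)⟩
    · exact ⟨fullTails_ge hx, le_maxTail hx⟩
  have e₁ := φ.eval_sub_eval (Shape.left_nonneg (Shape.after d)) hx0
  have e₂ := φ.eval_sub_eval hx0 (Shape.right_nonneg (Shape.after d))
  have l₁ := φ.len_nonneg (Shape.left_nonneg _) hbd.1
  have l₂ := φ.len_nonneg hx0 hbd.2
  rw [h] at e₁ e₂
  constructor <;> linarith

lemma lo_digit (h : φ.det = -1) {d : ℕ} (hd : 1 ≤ d) {u v a b : ℝ}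
    (hi : Shape.Inverts d u v a b) : lo (φ.digit d hd, Shape.after d) = φ.eval v := by
  rw [lo_eq_of_det (by rw [φ.det_digit, h, neg_neg]), φ.eval_digit hd (Shape.left_nonneg _),
    hi.left]

lemma hi_digit (h : φ.det = -1) {d : ℕ} (hd : 1 ≤ d) {u v a b : ℝ}
    (hi : Shape.Inverts d u v a b) : Cell.hi (φ.digit d hd, Shape.after d) = φ.eval u := by
  rw [hi_eq_of_det (by rw [φ.det_digit, h, neg_neg]), φ.eval_digit hd (Shape.right_nonneg _),
    hi.right]

lemma hi_sub_lo_digit {d : ℕ} (hd : 1 ≤ d) {u v a b : ℝ} (hi : Shape.Inverts d u v a b) :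
    Cell.hi (φ.digit d hd, Shape.after d) - lo (φ.digit d hd, Shape.after d) = φ.len u v := by
  rw [hi_sub_lo, φ.len_digit hd (Shape.left_nonneg _) (Shape.right_nonneg _), hi.left, hi.right]

lemma gap_digit {d : ℕ} (hd : 1 ≤ d) {u v a b : ℝ} (hi : Shape.Inverts d u v a b) :
    gap (φ.digit d hd, Shape.after d) = φ.len a b := by
  simp only [gap, φ.len_digit hd (Shape.gapL_nonneg _) (Shape.gapR_nonneg _), hi.gapR, hi.gapL]

lemma carrier_digit_subset_Icc (h : φ.det = -1) {d : ℕ} (hd : 1 ≤ d) :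
    carrier (φ.digit d hd, Shape.after d) ⊆
      Icc (lo (φ.digit d hd, Shape.after d)) (hi (φ.digit d hd, Shape.after d)) :=
  carrier_subset_Icc (by rw [φ.det_digit, h, neg_neg])

end Cell

lemma Mob.eval_le_eval {φ : Mob} (h : φ.det = -1) {x y : ℝ} (hx : 0 ≤ x) (hxy : x ≤ y) :
    φ.eval y ≤ φ.eval x := by
  have h₁ := φ.eval_sub_eval hx (hx.trans hxy)
  have h₂ := φ.len_nonneg hx hxy
  rw [h] at h₁
  linarith

lemma Mob.len_ext131_le_len_ext141_one (Φ : Mob) :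
    Φ.ext131.len ((7 + maxTail) / 25) ((1 + maxTail) / 5) ≤
      Φ.ext141.len ((2 + maxTail) / 5) maxTail := by
  have h1 := maxTail_sq
  have h2 := maxTail_cube
  have h3 := maxTail_gt
  have h4 := maxTail_lt
  apply Φ.len_ext131_le_len_ext141 <;> nlinarith

lemma Mob.len_ext141_le_len_ext131_two (Φ : Mob) :
    Φ.ext141.len ((3 - maxTail) / 5) ((2 + maxTail) / 5) ≤
      Φ.ext131.len ((1 + maxTail) / 5) ((3 - maxTail) / 5) := by
  have h1 := maxTail_sq
  have h2 := maxTail_cube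
  have h3 := maxTail_gt
  have h4 := maxTail_lt
  apply Φ.len_ext141_le_len_ext131 <;> nlinarith

lemma Mob.len_ext131_le_len_ext141_two (Φ : Mob) :
    Φ.ext131.len ((7 + maxTail) / 25) ((1 + maxTail) / 5) ≤
      Φ.ext141.len ((1 + maxTail) / 5) ((3 - maxTail) / 5) := by
  have h1 := maxTail_sq
  have h2 := maxTail_cube
  have h3 := maxTail_gt
  have h4 := maxTail_lt
  apply Φ.len_ext131_le_len_ext141 <;> nlinarith

lemma Mob.gap_ext141_le (Φ : Mob) {n : Cell}
    (hn : n = (Φ.ext141.digit 1 le_rfl, Shape.after 1) ∨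
      n = (Φ.ext141.digit 2 one_le_two, Shape.after 2)) :
    n.gap ≤ Cell.hi (Φ.ext131.digit 2 one_le_two, Shape.after 2) -
        Cell.lo (Φ.ext131.digit 2 one_le_two, Shape.after 2) ∧
      n.gap ≤ Cell.hi (Φ.ext131.digit 3 (by norm_num), Shape.after 3) -
        Cell.lo (Φ.ext131.digit 3 (by norm_num), Shape.after 3) := by
  have h1 := maxTail_sq
  have h2 := maxTail_cube
  have h3 := maxTail_gt
  have h4 := maxTail_lt
  rw [Cell.hi_sub_lo_digit _ Shape.inverts_two, Cell.hi_sub_lo_digit _ Shape.inverts_three]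
  rcases hn with rfl | rfl
  · rw [Cell.gap_digit _ Shape.inverts_one]
    constructor <;> apply Φ.len_ext141_le_len_ext131 <;> nlinarith
  · rw [Cell.gap_digit _ Shape.inverts_two]
    constructor <;> apply Φ.len_ext141_le_len_ext131 <;> nlinarith

lemma Mob.gap_ext131_le (Φ : Mob) {m : Cell}
    (hm : m = (Φ.ext131.digit 2 one_le_two, Shape.after 2) ∨
      m = (Φ.ext131.digit 3 (by norm_num), Shape.after 3)) :
    m.gap ≤ Cell.hi (Φ.ext141.digit 1 le_rfl, Shape.after 1) -
        Cell.lo (Φ.ext141.digit 1 le_rfl, Shape.after 1) ∧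
      m.gap ≤ Cell.hi (Φ.ext141.digit 2 one_le_two, Shape.after 2) -
        Cell.lo (Φ.ext141.digit 2 one_le_two, Shape.after 2) := by
  have h1 := maxTail_sq
  have h2 := maxTail_cube
  have h3 := maxTail_gt
  have h4 := maxTail_lt
  rw [Cell.hi_sub_lo_digit _ Shape.inverts_one, Cell.hi_sub_lo_digit _ Shape.inverts_two]
  rcases hm with rfl | rfl
  · rw [Cell.gap_digit _ Shape.inverts_two]
    constructor <;> apply Φ.len_ext131_le_len_ext141 <;> nlinarith
  · rw [Cell.gap_digit _ Shape.inverts_three]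
    constructor <;> apply Φ.len_ext131_le_len_ext141 <;> nlinarith

lemma carrier_union_add_union_eq_Icc {Φ : Mob} (hΦ : Φ.det = 1) :
    (Cell.carrier (Φ.ext141.digit 1 le_rfl, Shape.after 1) ∪
        Cell.carrier (Φ.ext141.digit 2 one_le_two, Shape.after 2)) +
      (Cell.carrier (Φ.ext131.digit 2 one_le_two, Shape.after 2) ∪
        Cell.carrier (Φ.ext131.digit 3 (by norm_num), Shape.after 3)) =
      Icc (Cell.lo (Φ.ext141.digit 1 le_rfl, Shape.after 1) +
          Cell.lo (Φ.ext131.digit 2 one_le_two, Shape.after 2))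
        (Cell.hi (Φ.ext141.digit 2 one_le_two, Shape.after 2) +
          Cell.hi (Φ.ext131.digit 3 (by norm_num), Shape.after 3)) := by
  have h3 := maxTail_gt
  have h4 := maxTail_lt
  have hf : Φ.ext141.det = -1 := by simp [Mob.ext141, Mob.det_digit, hΦ]
  have hg : Φ.ext131.det = -1 := by simp [Mob.ext131, Mob.det_digit, hΦ]
  have e₁ := Φ.ext141.eval_sub_eval (x := (2 + maxTail) / 5) (y := maxTail)
    (by linarith) (by linarith)
  have e₂ := Φ.ext141.eval_sub_eval (x := (3 - maxTail) / 5) (y := (2 + maxTail) / 5)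
    (by linarith) (by linarith)
  have e₃ := Φ.ext141.eval_sub_eval (x := (1 + maxTail) / 5) (y := (3 - maxTail) / 5)
    (by linarith) (by linarith)
  have e₄ := Φ.ext131.eval_sub_eval (x := (1 + maxTail) / 5) (y := (3 - maxTail) / 5)
    (by linarith) (by linarith)
  have e₅ := Φ.ext131.eval_sub_eval (x := (7 + maxTail) / 25) (y := (1 + maxTail) / 5)
    (by linarith) (by linarith)
  have e₆ := Mob.eval_le_eval hg (x := maxTail / 3) (y := (1 + maxTail) / 5)
    (by linarith) (by linarith)
  have l₁ := Φ.len_ext131_le_len_ext141_one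
  have l₂ := Φ.len_ext141_le_len_ext131_two
  have l₃ := Φ.len_ext131_le_len_ext141_two
  rw [hf] at e₁ e₂ e₃
  rw [hg] at e₄ e₅
  refine Cell.thickFamily.union_add_union_eq_Icc (Cell.carrier_digit_subset_Icc hf _)
    (Cell.carrier_digit_subset_Icc hf _) (Cell.carrier_digit_subset_Icc hg _)
    (Cell.carrier_digit_subset_Icc hg _) (fun _ => Φ.gap_ext141_le) (fun _ => Φ.gap_ext131_le)
    ?_ ?_ ?_ ?_ ?_ ?_ ?_ <;>
    simp only [Cell.thickFamily, Cell.lo_digit hf _ Shape.inverts_one,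
      Cell.lo_digit hf _ Shape.inverts_two, Cell.lo_digit hg _ Shape.inverts_two,
      Cell.lo_digit hg _ Shape.inverts_three, Cell.hi_digit hf _ Shape.inverts_one,
      Cell.hi_digit hf _ Shape.inverts_two, Cell.hi_digit hg _ Shape.inverts_two,
      Cell.hi_digit hg _ Shape.inverts_three]
  · exact Mob.eval_le_eval hf (by linarith) (by linarith)
  · exact Mob.eval_le_eval hf (by linarith) (by linarith)
  · exact Mob.eval_le_eval hg (by linarith) (by linarith)
  · exact Mob.eval_le_eval hg (by linarith) (by linarith)
  all_goals linarith

lemma Mob.Represents.cfVal_app_per31 {φ : Mob} {w : List ℕ} (h : φ.Represents w)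
    (hw : ∀ e ∈ w, 1 ≤ e) (hφ : φ.det = -1) {d : ℕ} (hd : 1 ≤ d) (hd2 : d ≤ 2) :
    cfVal (app (w ++ [d]) per31) = Cell.lo (φ.digit d hd, Shape.after d) := by
  have hw' : ∀ e ∈ w ++ [d], 1 ≤ e := by simpa [or_imp, forall_and, hd] using hw
  rw [(h.digit hd).cfVal_app hw' per31_mem_Dset, cfVal_per31,
    Cell.lo_eq_of_det (by rw [φ.det_digit, hφ, neg_neg]), Shape.after, if_pos hd2, Shape.left]

lemma Mob.Represents.cfVal_app_per13 {φ : Mob} {w : List ℕ} (h : φ.Represents w)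
    (hw : ∀ e ∈ w, 1 ≤ e) (hφ : φ.det = -1) {d : ℕ} (hd : 1 ≤ d) :
    cfVal (app (w ++ [d]) per13) = Cell.hi (φ.digit d hd, Shape.after d) := by
  have hw' : ∀ e ∈ w ++ [d], 1 ≤ e := by simpa [or_imp, forall_and, hd] using hw
  rw [(h.digit hd).cfVal_app hw' per13_mem_Dset, cfVal_per13,
    Cell.hi_eq_of_det (by rw [φ.det_digit, hφ, neg_neg]), Shape.after]
  split_ifs <;> rfl

/-- For every `s ≥ 1`, `(K(b^s,1,1) ∪ K(b^s,1,2)) + (K(c^s,1,2) ∪ K(c^s,1,3))` is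
the closed interval
`[[0; b^s,1,1,\overline{3,1}] + [0; c^s,1,2,\overline{3,1}],
  [0; b^s,1,2,\overline{1,3}] + [0; c^s,1,3,\overline{1,3}]]`. -/
theorem sum_Kbs1p_Kcs1q (s : ℕ) (hs : 1 ≤ s) :
    (Kb (bW s ++ [1, 1]) ∪ Kb (bW s ++ [1, 2])) +
        (Kb (cW s ++ [1, 2]) ∪ Kb (cW s ++ [1, 3])) =
      Set.Icc
        (cfVal (app (bW s ++ [1, 1]) per31) + cfVal (app (cW s ++ [1, 2]) per31))
        (cfVal (app (bW s ++ [1, 2]) per13) + cfVal (app (cW s ++ [1, 3]) per13)) := by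
  obtain ⟨k, rfl⟩ := Nat.exists_eq_add_of_le' hs
  obtain ⟨Φ, hΦ, hdet⟩ := exists_represents_bW k
  have hf : Φ.ext141.Represents (bW (k + 1) ++ [1]) := by
    rw [bW_succ]
    exact ((hΦ.digit le_rfl).digit _).digit le_rfl
  have hg : Φ.ext131.Represents (cW (k + 1) ++ [1]) := by
    have hc : cW (k + 1) = bW k ++ [1] ++ [3] := by simp [cW]
    rw [hc]
    exact ((hΦ.digit le_rfl).digit _).digit le_rfl
  have hwf : ∀ e ∈ bW (k + 1) ++ [1], 1 ≤ e := by
    simpa [or_imp, forall_and] using fun e => one_le_of_mem_bW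
  have hwg : ∀ e ∈ cW (k + 1) ++ [1], 1 ≤ e := by
    simpa [cW, or_imp, forall_and] using fun e => one_le_of_mem_bW
  have hdf : Φ.ext141.det = -1 := by simp [Mob.ext141, Mob.det_digit, hdet]
  have hdg : Φ.ext131.det = -1 := by simp [Mob.ext131, Mob.det_digit, hdet]
  have hw : ∀ (w : List ℕ) (d : ℕ), w ++ [1, d] = w ++ [1] ++ [d] := by simp
  simp only [hw]
  rw [hf.Kb_eq hwf (by simp) le_rfl, hf.Kb_eq hwf (by simp) one_le_two,
    hg.Kb_eq hwg (by simp) one_le_two, hg.Kb_eq hwg (by simp) (by norm_num : 1 ≤ 3),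
    hf.cfVal_app_per31 hwf hdf le_rfl one_le_two, hg.cfVal_app_per31 hwg hdg one_le_two le_rfl,
    hf.cfVal_app_per13 hwf hdf one_le_two, hg.cfVal_app_per13 hwg hdg (by norm_num : 1 ≤ 3)]
  exact carrier_union_add_union_eq_Icc hdet
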